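/- arXiv:2001.06470 — 4 statements merged into one kernel-verified Lean document; each statement's English description precedes it below -/
import Mathlib

section
/- Every companion unit lower Hessenberg matrix belongs to the set 𝒞̃: if A is an n×n companion matrix which is ULH, then A is a ULH superpattern of some matrix C_{i_1,…,i_n} of 𝒞. -/
open Polynomial Matrix

noncomputable section

/-- A square matrix is *unit lower Hessenberg* (ULH): every entry on the
superdiagonal equals `1` and every entry above the superdiagonal equals `0`. -/
def IsULH {R : Type*} [Zero R] [One R] {m : ℕ} (A : Matrix (Fin m) (Fin m) R) : Prop :=
  (∀ i j : Fin m, (j : ℕ) = (i : ℕ) + 1 → A i j = 1) ∧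
  (∀ i j : Fin m, (i : ℕ) + 1 < (j : ℕ) → A i j = 0)

/-- The total order `≺` on positions: `(i,j) ≺ (i',j')` iff `i−j < i'−j'`, or
`i−j = i'−j'` and `i < i'`. -/
def Prec {m : ℕ} (a b : Fin m × Fin m) : Prop :=
  ((a.1 : ℕ) - (a.2 : ℕ) < (b.1 : ℕ) - (b.2 : ℕ)) ∨
  ((a.1 : ℕ) - (a.2 : ℕ) = (b.1 : ℕ) - (b.2 : ℕ) ∧ (a.1 : ℕ) < (b.1 : ℕ))

/-- `pos` is a valid family of variable positions for a matrix of `ℋ`: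
each position is on or below the main diagonal, and the positions are
strictly increasing in the order `≺`. -/
def IsHPos {m : ℕ} (pos : Fin m → Fin m × Fin m) : Prop :=
  (∀ k, ((pos k).2 : ℕ) ≤ ((pos k).1 : ℕ)) ∧
  (∀ k l : Fin m, k < l → Prec (pos k) (pos l))

/-- `pos` is a valid family of variable positions for a matrix of `ℬ`:
in addition all variables lie in a common `t`-block, i.e.
`max j_k ≤ min i_k`. -/
def IsBPos {m : ℕ} (pos : Fin m → Fin m × Fin m) : Prop :=
  IsHPos pos ∧ ∀ k l : Fin m, ((pos k).2 : ℕ) ≤ ((pos l).1 : ℕ)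

/-- The ULH matrix `H_{(i₁,j₁),…,(iₙ,jₙ)}` with `2n−1` nonzero entries: ones on the
superdiagonal and the variable `xₖ` at position `pos k` (0-indexed). -/
def HMat (F : Type*) [Field F] {n : ℕ} (pos : Fin n → Fin n × Fin n) :
    Matrix (Fin n) (Fin n) (MvPolynomial (Fin n) F) :=
  fun i j => (if (j : ℕ) = (i : ℕ) + 1 then 1 else 0) +
    ∑ k : Fin n, if pos k = (i, j) then MvPolynomial.X k else 0

/-- The positions of the variables of `C_{i₁,…,iₙ}`: in 1-based terms `xₖ` lies at
`(iₖ, iₖ−k+1)`; here 0-indexed, given the row function `r`, the variable `x_{k+1}`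
lies at `(r k, r k − k)`. -/
def CPos {n : ℕ} (r : Fin n → Fin n) (k : Fin n) : Fin n × Fin n :=
  (r k, ⟨(r k : ℕ) - (k : ℕ), lt_of_le_of_lt (Nat.sub_le _ _) (r k).isLt⟩)

/-- The condition on the row indices defining the set `𝒞`: in 1-based terms
`k ≤ iₖ` and `iₖ−k+1 ≤ i₁ ≤ iₖ` for `k = 1,…,n`. -/
def IsCIdx {n : ℕ} (hn : 0 < n) (r : Fin n → Fin n) : Prop :=
  ∀ k : Fin n, (k : ℕ) ≤ (r k : ℕ) ∧
    (r k : ℕ) - (k : ℕ) ≤ (r ⟨0, hn⟩ : ℕ) ∧ (r ⟨0, hn⟩ : ℕ) ≤ (r k : ℕ)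

/-- The matrix `C_{i₁,…,iₙ}`. -/
def CMat (F : Type*) [Field F] {n : ℕ} (r : Fin n → Fin n) :
    Matrix (Fin n) (Fin n) (MvPolynomial (Fin n) F) :=
  HMat F (CPos r)

/-- The condition on the row indices defining the set `𝒢`: besides the `𝒞` conditions,
the rows of the variables are exactly `i₁,…,n` and their columns exactly `1,…,i₁`. -/
def IsGIdx {n : ℕ} (hn : 0 < n) (r : Fin n → Fin n) : Prop :=
  IsCIdx hn r ∧
  (∀ i : Fin n, (∃ k, r k = i) ↔ (r ⟨0, hn⟩ : ℕ) ≤ (i : ℕ)) ∧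
  (∀ j : Fin n, (∃ k, (r k : ℕ) - (k : ℕ) = (j : ℕ)) ↔ (j : ℕ) ≤ (r ⟨0, hn⟩ : ℕ))

/-- The condition on the row indices defining the set `ℱ` of Fiedler companion
matrices: besides the `𝒢` conditions, consecutive variables lie in the same row or
the same column, i.e. `i_{k+1} = i_k` or `i_{k+1} = i_k + 1`. -/
def IsFIdx {n : ℕ} (hn : 0 < n) (r : Fin n → Fin n) : Prop :=
  IsGIdx hn r ∧
  ∀ k l : Fin n, (l : ℕ) = (k : ℕ) + 1 → (r l = r k ∨ (r l : ℕ) = (r k : ℕ) + 1)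

/-- `B` is a *ULH superpattern* of `A`: `B` is obtained from `A` by replacing some
(possibly none) zero entries of `A` lying below the superdiagonal by nonzero
constants of `F`. -/
def IsULHSuperpatternOf {F : Type*} [Field F] {n : ℕ}
    (B A : Matrix (Fin n) (Fin n) (MvPolynomial (Fin n) F)) : Prop :=
  (∀ i j : Fin n, (i : ℕ) < (j : ℕ) → B i j = A i j) ∧
  (∀ i j : Fin n, (j : ℕ) ≤ (i : ℕ) →
    B i j = A i j ∨ (A i j = 0 ∧ ∃ c : F, c ≠ 0 ∧ B i j = MvPolynomial.C c))

/-- `A` is a *companion matrix*: `n` of its entries are the variables `x₁,…,xₙ`,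
the remaining entries are constants of `F`, and
`det(λI − A) = λⁿ − x₁λ^{n−1} − ⋯ − xₙ`. -/
def IsCompanion {F : Type*} [Field F] {n : ℕ}
    (A : Matrix (Fin n) (Fin n) (MvPolynomial (Fin n) F)) : Prop :=
  (∃ pos : Fin n → Fin n × Fin n, Function.Injective pos ∧
    (∀ k : Fin n, A (pos k).1 (pos k).2 = MvPolynomial.X k) ∧
    (∀ i j : Fin n, (∀ k, pos k ≠ (i, j)) → ∃ c : F, A i j = MvPolynomial.C c)) ∧
  A.charpoly = Polynomial.X ^ n -
    ∑ k : Fin n, Polynomial.C (MvPolynomial.X k) * Polynomial.X ^ (n - 1 - (k : ℕ))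

/-- `A` is a *PB-companion matrix* (companion with respect to a polynomial basis):
`n` of its entries are the variables `x₁,…,xₙ`, the remaining entries are constants
of `F`, and `det(λI − A) = pₙ(λ) − x₁p_{n−1}(λ) − ⋯ − xₙp₀(λ)` for some basis
`{pₙ,…,p₀}` of the space `F_n[λ]` of polynomials of degree at most `n`. -/
def IsPBCompanion {F : Type*} [Field F] {n : ℕ}
    (A : Matrix (Fin n) (Fin n) (MvPolynomial (Fin n) F)) : Prop :=
  (∃ pos : Fin n → Fin n × Fin n, Function.Injective pos ∧
    (∀ k : Fin n, A (pos k).1 (pos k).2 = MvPolynomial.X k) ∧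
    (∀ i j : Fin n, (∀ k, pos k ≠ (i, j)) → ∃ c : F, A i j = MvPolynomial.C c)) ∧
  ∃ p : Fin (n + 1) → Polynomial F,
    (∀ i, p i ∈ Polynomial.degreeLT F (n + 1)) ∧
    LinearIndependent F p ∧
    Submodule.span F (Set.range p) = Polynomial.degreeLT F (n + 1) ∧
    A.charpoly = (p ⟨n, n.lt_succ_self⟩).map (MvPolynomial.C : F →+* MvPolynomial (Fin n) F) -
      ∑ k : Fin n, Polynomial.C (MvPolynomial.X k) *
        (p ⟨n - 1 - (k : ℕ), by omega⟩).map (MvPolynomial.C : F →+* MvPolynomial (Fin n) F)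

/-- The constant part of `A`: set `x₁ = ⋯ = xₙ = 0` in every entry. -/
def constPart {F : Type*} [Field F] {n : ℕ}
    (A : Matrix (Fin n) (Fin n) (MvPolynomial (Fin n) F)) : Matrix (Fin n) (Fin n) F :=
  A.map (fun q => MvPolynomial.eval (fun _ => (0 : F)) q)

/-- The leading principal submatrix `A[1,…,m]` of order `m`. -/
def leadSub {R : Type*} {n : ℕ} (A : Matrix (Fin n) (Fin n) R) (m : ℕ) (h : m ≤ n) :
    Matrix (Fin m) (Fin m) R :=
  A.submatrix (Fin.castLE h) (Fin.castLE h)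

/-- The trailing principal submatrix `A[n−m+1,…,n]` of order `m`. -/
def trailSub {R : Type*} {n : ℕ} (A : Matrix (Fin n) (Fin n) R) (m : ℕ) (h : m ≤ n) :
    Matrix (Fin m) (Fin m) R :=
  A.submatrix (fun i => ⟨n - m + (i : ℕ), by omega⟩) (fun i => ⟨n - m + (i : ℕ), by omega⟩)

/-- A matrix whose entries are all constants of `F`. -/
def IsConstMatrix {F : Type*} [Field F] {n m : ℕ}
    (M : Matrix (Fin m) (Fin m) (MvPolynomial (Fin n) F)) : Prop :=
  ∀ i j, ∃ c : F, M i j = MvPolynomial.C c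

/-- Membership in `𝔑^m_L(n₁,…,n_s)`: a constant ULH matrix of order `m` whose
leading principal submatrix of order `ns h` is nilpotent whenever `ns h ≠ 0`. -/
def MemNL {F : Type*} [Field F] {m : ℕ} (M : Matrix (Fin m) (Fin m) F)
    {s : ℕ} (ns : Fin s → ℕ) (hns : ∀ h, ns h ≤ m) : Prop :=
  IsULH M ∧ ∀ h : Fin s, ns h ≠ 0 → IsNilpotent (leadSub M (ns h) (hns h))

/-- Membership in `𝔑^m_T(n₁,…,n_s)`: a constant ULH matrix of order `m` whose
trailing principal submatrix of order `ns h` is nilpotent whenever `ns h ≠ 0`. -/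
def MemNT {F : Type*} [Field F] {m : ℕ} (M : Matrix (Fin m) (Fin m) F)
    {s : ℕ} (ns : Fin s → ℕ) (hns : ∀ h, ns h ≤ m) : Prop :=
  IsULH M ∧ ∀ h : Fin s, ns h ≠ 0 → IsNilpotent (trailSub M (ns h) (hns h))

/-- `s_k(A)`: the sum of the entries of the `k`-subdiagonal of `A`. -/
def subdiagSum {F : Type*} [Field F] {n : ℕ}
    (A : Matrix (Fin n) (Fin n) (MvPolynomial (Fin n) F)) (k : ℕ) : MvPolynomial (Fin n) F :=
  ∑ i : Fin n, ∑ j : Fin n, if (i : ℕ) = (j : ℕ) + k then A i j else 0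

/-- The upper shift matrix `Uₘ`: ones on the superdiagonal, zeros elsewhere. -/
def Ushift (R : Type*) [Zero R] [One R] (m : ℕ) : Matrix (Fin m) (Fin m) R :=
  fun i j => if (j : ℕ) = (i : ℕ) + 1 then 1 else 0

/-- The backward identity matrix `Jₘ`: ones on the antidiagonal, zeros elsewhere. -/
def Jmat (R : Type*) [Zero R] [One R] (m : ℕ) : Matrix (Fin m) (Fin m) R :=
  fun i j => if (i : ℕ) + (j : ℕ) = m - 1 then 1 else 0

/-- The principal submatrix `M[b,…,e]` on rows and columns `b,…,e` (0-indexed). -/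
def rangeSub {R : Type*} {m : ℕ} (M : Matrix (Fin m) (Fin m) R) (b e : ℕ) (h : e < m) :
    Matrix (Fin (e + 1 - b)) (Fin (e + 1 - b)) R :=
  M.submatrix (fun i => ⟨b + (i : ℕ), by omega⟩) (fun i => ⟨b + (i : ℕ), by omega⟩)

/-- Deleting row `i` and column `j ≤ i` of the characteristic matrix of a ULH matrix leaves a
block lower triangular matrix, whose middle block has diagonal entries `-1`. -/
theorem IsULH.adjugate_charmatrix {R : Type*} [CommRing R] {m : ℕ}
    {B : Matrix (Fin (m + 1)) (Fin (m + 1)) R} (hB : IsULH B) {i j : Fin (m + 1)} (hij : j ≤ i) :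
    B.charmatrix.adjugate j i =
      (leadSub B j (by omega)).charpoly * (trailSub B (m - i) (by omega)).charpoly := by
  have hij' : (j : ℕ) ≤ i := hij
  have hi := i.isLt
  have above : ∀ a b : Fin (m + 1), (a : ℕ) + 1 < b → B.charmatrix a b = 0 := fun a b h => by
    rw [charmatrix_apply_ne _ _ _ (by rintro rfl; omega), hB.2 a b h, map_zero, neg_zero]
  have super : ∀ a b : Fin (m + 1), (b : ℕ) = a + 1 → B.charmatrix a b = -1 := fun a b h => by
    rw [charmatrix_apply_ne _ _ _ (by rintro rfl; omega), hB.1 a b h, map_one]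
  have val_succAbove : ∀ (c : Fin (m + 1)) (a : Fin m),
      (c.succAbove a : ℕ) = if (a : ℕ) < c then (a : ℕ) else a + 1 := fun c a => by
    simp only [Fin.succAbove, Fin.lt_def, Fin.val_castSucc]
    split_ifs <;> rfl
  set S := B.charmatrix.submatrix i.succAbove j.succAbove with hS
  have hlead : (S.toSquareBlockProp fun a => (a : ℕ) < j).det =
      (leadSub B j (by omega)).charpoly := by
    let e : Fin j ≃ {a : Fin m // (a : ℕ) < j} :=
      ⟨fun a => ⟨⟨a, by omega⟩, a.2⟩, fun a => ⟨a.1, a.2⟩, fun _ => rfl, fun _ => rfl⟩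
    rw [← det_submatrix_equiv_self e, Matrix.charpoly]
    congr 1
    ext1 a b
    have ha : i.succAbove (e a).1 = Fin.castLE (by omega) a := by
      ext; rw [val_succAbove]; simp only [e, Equiv.coe_fn_mk, Fin.val_castLE]; split_ifs <;> omega
    have hb : j.succAbove (e b).1 = Fin.castLE (by omega) b := by
      ext; rw [val_succAbove]; simp only [e, Equiv.coe_fn_mk, Fin.val_castLE]; split_ifs <;> omega
    simp only [submatrix_apply, toSquareBlockProp_def, of_apply, hS, ha, hb, leadSub,
      charmatrix_apply, diagonal_apply, Fin.ext_iff, Fin.val_castLE]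
  set T := S.toSquareBlockProp fun a => ¬ (a : ℕ) < j with hT
  have hmid : (T.toSquareBlockProp fun a => (a.1 : ℕ) < i).det = (-1) ^ ((i : ℕ) - j) := by
    let e : Fin ((i : ℕ) - j) ≃ {a : {a : Fin m // ¬ (a : ℕ) < j} // (a.1 : ℕ) < i} :=
      ⟨fun a => ⟨⟨⟨j + a, by omega⟩, by simp⟩, by simp only; omega⟩,
        fun a => ⟨a.1.1 - j, by have := a.1.2; have := a.2; omega⟩, fun a => by simp,
        fun a => by have := a.1.2; ext; simp only; omega⟩
    rw [← det_submatrix_equiv_self e, det_of_isLowerTriangular]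
    · refine (Finset.prod_congr rfl fun a _ => super _ _ ?_).trans (by simp)
      rw [val_succAbove, val_succAbove]
      simp only [e, Equiv.coe_fn_mk]
      split_ifs <;> omega
    · intro a b hab
      have hab' : (a : ℕ) < b := hab
      refine above _ _ ?_
      rw [val_succAbove, val_succAbove]
      simp only [e, Equiv.coe_fn_mk]
      split_ifs <;> omega
  have htrail : (T.toSquareBlockProp fun a => ¬ (a.1 : ℕ) < i).det =
      (trailSub B (m - i) (by omega)).charpoly := by
    let e : Fin (m - i) ≃ {a : {a : Fin m // ¬ (a : ℕ) < j} // ¬ (a.1 : ℕ) < i} :=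
      ⟨fun a => ⟨⟨⟨i + a, by omega⟩, by simp only; omega⟩, by simp⟩,
        fun a => ⟨a.1.1 - i, by omega⟩, fun a => by simp,
        fun a => by ext; simp only; omega⟩
    rw [← det_submatrix_equiv_self e, Matrix.charpoly]
    congr 1
    ext1 a b
    have ha : i.succAbove (e a).1.1 = ⟨m + 1 - (m - i) + a, by omega⟩ := by
      ext; rw [val_succAbove]; simp only [e, Equiv.coe_fn_mk]; split_ifs <;> omega
    have hb : j.succAbove (e b).1.1 = ⟨m + 1 - (m - i) + b, by omega⟩ := by
      ext; rw [val_succAbove]; simp only [e, Equiv.coe_fn_mk]; split_ifs <;> omega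
    simp only [submatrix_apply, toSquareBlockProp_def, of_apply, hT, hS, ha, hb, trailSub,
      charmatrix_apply, diagonal_apply, Fin.ext_iff, Nat.add_left_cancel_iff]
  rw [adjugate_fin_succ_eq_det_submatrix, ← hS,
    twoBlockTriangular_det' S (fun a => (a : ℕ) < j), hlead,
    twoBlockTriangular_det' T (fun a => (a.1 : ℕ) < i), hmid, htrail]
  · have hsign : (-1 : Polynomial R) ^ ((i : ℕ) + j) * (-1) ^ ((i : ℕ) - j) = 1 := by
      rw [← pow_add]
      exact Even.neg_one_pow ⟨i, by omega⟩
    linear_combination (leadSub B j (by omega)).charpoly *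
      (trailSub B (m - i) (by omega)).charpoly * hsign
  · intro a ha b hb
    refine above _ _ ?_
    rw [val_succAbove, val_succAbove]
    split_ifs <;> omega
  · intro a ha b hb
    refine above _ _ ?_
    rw [val_succAbove, val_succAbove]
    split_ifs <;> omega

/-- The characteristic polynomial is affine in each entry of the matrix. -/
theorem charpoly_sub_charpoly_of_eq_add_single {R ι : Type*} [CommRing R] [Fintype ι]
    [DecidableEq ι] (B : Matrix ι ι R) (i j : ι) :
    (B + Matrix.single i j 1).charpoly = B.charpoly - B.charmatrix.adjugate j i := by
  have h : (B + Matrix.single i j 1).charmatrix =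
      B.charmatrix.updateRow i (B.charmatrix i + (-1 : Polynomial R) • Pi.single j 1) := by
    ext1 a b
    by_cases ha : a = i
    · subst ha
      by_cases hb : b = j
      · subst hb; simp [charmatrix_apply]; ring
      · simp [charmatrix_apply, Ne.symm hb, hb]
    · simp [charmatrix_apply, updateRow_ne ha, Matrix.single, Ne.symm ha]
  rw [Matrix.charpoly, h, det_updateRow_add, det_updateRow_smul, updateRow_eq_self,
    ← adjugate_apply, Matrix.charpoly]
  ring

theorem charpoly_eq_X_pow_of_dvd {R ι : Type*} [CommRing R] [IsDomain R] [Fintype ι]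
    [DecidableEq ι] {M : Matrix ι ι R} {N : ℕ} (h : M.charpoly ∣ Polynomial.X ^ N) :
    M.charpoly = Polynomial.X ^ Fintype.card ι := by
  obtain ⟨d, -, hd⟩ := (dvd_prime_pow Polynomial.prime_X N).1 h
  have := Polynomial.eq_of_monic_of_associated M.charpoly_monic (Polynomial.monic_X_pow d) hd
  rw [← M.charpoly_natDegree_eq_dim, this, Polynomial.natDegree_X_pow]

theorem trace_eq_zero_of_charpoly_dvd_X_pow {R ι : Type*} [CommRing R] [IsDomain R] [Fintype ι]
    [DecidableEq ι] {M : Matrix ι ι R} {N : ℕ} (h : M.charpoly ∣ Polynomial.X ^ N) :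
    M.trace = 0 := by
  cases isEmpty_or_nonempty ι
  · simp [Matrix.trace]
  · rw [trace_eq_neg_charpoly_coeff, charpoly_eq_X_pow_of_dvd h, Polynomial.coeff_X_pow,
      if_neg (Nat.sub_one_lt Fintype.card_ne_zero).ne, neg_zero]

/-- If a variable occurs in exactly one entry of `B`, a diagonal one, and the characteristic
polynomial of a principal submatrix of `B` is a power of `X`, then that submatrix avoids it. -/
theorem notMem_range_of_charpoly_dvd_X_pow {F σ κ ι : Type*} [Field F] [Fintype ι] [DecidableEq ι]
    [DecidableEq κ] {B : Matrix κ κ (MvPolynomial σ F)} {s : σ} {d : κ}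
    (hB : ∀ a, (B a a).coeff (Finsupp.single s 1) = if a = d then 1 else 0)
    {e : ι → κ} (he : Function.Injective e) {N : ℕ}
    (h : (B.submatrix e e).charpoly ∣ Polynomial.X ^ N) : d ∉ Set.range e := by
  rintro ⟨t, rfl⟩
  have := congrArg (MvPolynomial.coeff (Finsupp.single s 1)) (trace_eq_zero_of_charpoly_dvd_X_pow h)
  simp [Matrix.trace, MvPolynomial.coeff_sum, hB, he.eq_iff] at this

/-- The position of a variable of a companion ULH matrix is on the expected subdiagonal, and the
diagonal variable `x₁` lies weakly between its column and its row. -/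
theorem IsCompanion.pos_of_isULH {F : Type*} [Field F] {n : ℕ} (hn : 0 < n)
    {A : Matrix (Fin n) (Fin n) (MvPolynomial (Fin n) F)} (hULH : IsULH A)
    (hchar : A.charpoly = Polynomial.X ^ n -
      ∑ k : Fin n, Polynomial.C (MvPolynomial.X k) * Polynomial.X ^ (n - 1 - (k : ℕ)))
    {pos : Fin n → Fin n × Fin n} (hinj : Function.Injective pos)
    (hvar : ∀ k : Fin n, A (pos k).1 (pos k).2 = MvPolynomial.X k)
    (hconst : ∀ i j : Fin n, (∀ k, pos k ≠ (i, j)) → ∃ c : F, A i j = MvPolynomial.C c)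
    (k : Fin n) :
    ((pos k).1 : ℕ) = (pos k).2 + k ∧
      ((pos ⟨0, hn⟩).1 = (pos ⟨0, hn⟩).2 →
        (pos k).2 ≤ (pos ⟨0, hn⟩).1 ∧ (pos ⟨0, hn⟩).1 ≤ (pos k).1) := by
  obtain ⟨m, rfl⟩ : ∃ m, n = m + 1 := ⟨n - 1, by omega⟩
  rcases hp : pos k with ⟨i, j⟩
  have hAij : A i j = MvPolynomial.X k := by simpa [hp] using hvar k
  have hij : j ≤ i := by
    by_contra! hlt
    have hlt' : (i : ℕ) < j := hlt
    rcases (show (j : ℕ) = i + 1 ∨ (i : ℕ) + 1 < j by omega) with h | h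
    · have := congrArg MvPolynomial.totalDegree (hAij.symm.trans (hULH.1 i j h))
      simp at this
    · exact MvPolynomial.X_ne_zero k (hAij.symm.trans (hULH.2 i j h))
  -- specialise the variable `x_k` to `c`, keeping the others
  let φ (c : F) : MvPolynomial (Fin (m + 1)) F →+* MvPolynomial (Fin (m + 1)) F :=
    (MvPolynomial.aeval
      (Function.update (MvPolynomial.X : _ → MvPolynomial (Fin (m + 1)) F) k
        (MvPolynomial.C c))).toRingHom
  have φ_C (c a : F) : φ c (MvPolynomial.C a) = MvPolynomial.C a := by simp [φ]
  have φ_X (c : F) : φ c (MvPolynomial.X k) = MvPolynomial.C c := by simp [φ]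
  have φ_X_ne (c : F) {l : Fin (m + 1)} (hl : l ≠ k) :
      φ c (MvPolynomial.X l) = MvPolynomial.X l := by simp [φ, hl]
  have entry (a b : Fin (m + 1)) :
      (∃ l, pos l = (a, b) ∧ A a b = MvPolynomial.X l) ∨ ∃ c : F, A a b = MvPolynomial.C c := by
    by_cases h : ∃ l, pos l = (a, b)
    · obtain ⟨l, hl⟩ := h
      exact .inl ⟨l, hl, by simpa [hl] using hvar l⟩
    · exact .inr (hconst a b (by simpa using h))
  set B := A.map (φ 0) with hBdef
  have hB : IsULH B := ⟨fun a b h => by simp [hBdef, hULH.1 a b h],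
    fun a b h => by simp [hBdef, hULH.2 a b h]⟩
  have hB1 : A.map (φ 1) = B + Matrix.single i j 1 := by
    ext1 a b
    simp only [hBdef, map_apply, Matrix.add_apply]
    by_cases hab : i = a ∧ j = b
    · obtain ⟨rfl, rfl⟩ := hab
      simp [hAij, φ_X]
    · rw [Matrix.single_apply, if_neg hab, add_zero]
      rcases entry a b with ⟨l, hl, h⟩ | ⟨c, h⟩
      · have hlk : l ≠ k := by rintro rfl; rw [hp] at hl; exact hab (by simpa using hl)
        rw [h, φ_X_ne _ hlk, φ_X_ne _ hlk]
      · rw [h, φ_C, φ_C]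
  have hfactor : (leadSub B j (by omega)).charpoly * (trailSub B (m - i) (by omega)).charpoly =
      Polynomial.X ^ (m - (k : ℕ)) := by
    rw [← hB.adjugate_charmatrix hij]
    have h := charpoly_sub_charpoly_of_eq_add_single B i j
    rw [← hB1, hBdef, charpoly_map, charpoly_map, hchar, ← hBdef] at h
    simp only [Polynomial.map_sub, Polynomial.map_pow, Polynomial.map_X, Polynomial.map_sum,
      Polynomial.map_mul, Polynomial.map_C] at h
    rw [← Finset.add_sum_erase _ _ (Finset.mem_univ k),
      ← Finset.add_sum_erase _ _ (Finset.mem_univ k)] at h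
    rw [Finset.sum_congr rfl fun l hl => by
      rw [φ_X_ne 1 (Finset.ne_of_mem_erase hl), ← φ_X_ne 0 (Finset.ne_of_mem_erase hl)]] at h
    simp only [φ_X, map_one, map_zero, one_mul, zero_mul, Nat.add_sub_cancel] at h
    linear_combination h
  have hdeg := congrArg Polynomial.natDegree hfactor
  rw [(charpoly_monic _).natDegree_mul (charpoly_monic _), charpoly_natDegree_eq_dim,
    charpoly_natDegree_eq_dim, Polynomial.natDegree_X_pow, Fintype.card_fin,
    Fintype.card_fin] at hdeg
  have hij' : (j : ℕ) ≤ i := hij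
  refine ⟨by simp only; omega, fun hdiag => ?_⟩
  by_cases hk : k = ⟨0, hn⟩
  · subst hk
    rw [hp] at hdiag ⊢
    simp only at hdiag
    simp [hdiag]
  have hcoeff (a : Fin (m + 1)) : (B a a).coeff (Finsupp.single ⟨0, hn⟩ 1) =
      if a = (pos ⟨0, hn⟩).1 then 1 else 0 := by
    split_ifs with ha
    · have := hvar ⟨0, hn⟩
      rw [← hdiag, ← ha] at this
      rw [hBdef, map_apply, this, φ_X_ne 0 (Ne.symm hk), MvPolynomial.coeff_X, if_pos rfl]
    · rw [hBdef, map_apply]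
      rcases entry a a with ⟨l, hl, h⟩ | ⟨c, h⟩
      · have hl0 : l ≠ ⟨0, hn⟩ := by rintro rfl; exact ha (by rw [hl])
        rw [h]
        by_cases hlk : l = k
        · rw [hlk, φ_X, map_zero, MvPolynomial.coeff_zero]
        · rw [φ_X_ne 0 hlk, MvPolynomial.coeff_X, if_neg]
          simpa [Finsupp.single_left_inj] using hl0
      · rw [h, φ_C, MvPolynomial.coeff_C, if_neg]
        simp [eq_comm]
  have hlead := notMem_range_of_charpoly_dvd_X_pow hcoeff (Fin.castLE_injective (by omega))
    (Dvd.intro _ hfactor : (leadSub B j (by omega)).charpoly ∣ _)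
  have htrail := notMem_range_of_charpoly_dvd_X_pow hcoeff
    (fun a b h => by simpa [Fin.ext_iff] using h)
    (Dvd.intro_left _ hfactor : (trailSub B (m - i) (by omega)).charpoly ∣ _)
  constructor
  · by_contra! h
    exact hlead ⟨⟨(pos ⟨0, hn⟩).1, h⟩, rfl⟩
  · by_contra! h
    have h' : (i : ℕ) < (pos ⟨0, hn⟩).1 := h
    exact htrail ⟨⟨(pos ⟨0, hn⟩).1 - (i + 1), by omega⟩, by ext; simp only; omega⟩

/-- Every companion ULH matrix belongs to `𝒞̃`: it is a ULH
superpattern of some matrix `C_{i₁,…,iₙ}` of `𝒞`. -/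
theorem companion_ULH_mem_Ctilde {F : Type*} [Field F] {n : ℕ} (hn : 0 < n)
    (A : Matrix (Fin n) (Fin n) (MvPolynomial (Fin n) F))
    (hULH : IsULH A) (hcomp : IsCompanion A) :
    ∃ r : Fin n → Fin n, IsCIdx hn r ∧ IsULHSuperpatternOf A (CMat F r) := by
  obtain ⟨⟨pos, hinj, hvar, hconst⟩, hchar⟩ := hcomp
  have hpos := IsCompanion.pos_of_isULH hn hULH hchar hinj hvar hconst
  have hdiag : (pos ⟨0, hn⟩).1 = (pos ⟨0, hn⟩).2 := Fin.ext (hpos ⟨0, hn⟩).1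
  have hC : CPos (fun k => (pos k).1) = pos := by
    funext k
    have := (hpos k).1
    ext
    · rfl
    · simp only [CPos]; omega
  refine ⟨fun k => (pos k).1, fun k => ?_, fun i j hij => ?_, fun i j hij => ?_⟩
  · have h1 := (hpos k).1
    obtain ⟨h2, h3⟩ := (hpos k).2 hdiag
    rw [Fin.le_def] at h2 h3
    exact ⟨by simp only; omega, by simp only; omega, h3⟩
  · rw [CMat, hC, HMat, Finset.sum_eq_zero fun k _ => if_neg ?_, add_zero]
    · split_ifs with h
      · exact hULH.1 i j h
      · exact hULH.2 i j (by omega)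
    · intro h
      have := (hpos k).1
      rw [h] at this
      simp only at this
      omega
  · rw [CMat, hC, HMat, if_neg (by omega), zero_add]
    by_cases h : ∃ k, pos k = (i, j)
    · obtain ⟨k, hk⟩ := h
      left
      have := hvar k
      rw [hk] at this
      simp [← hk, hinj.eq_iff, this]
    · push Not at h
      rw [Finset.sum_eq_zero fun k _ => if_neg (h k)]
      obtain ⟨c, hc⟩ := hconst i j h
      by_cases hc0 : c = 0
      · exact .inl (by rw [hc, hc0, map_zero])
      · exact .inr ⟨rfl, c, hc0, hc⟩
end
end

section
/- Let A be a ULH superpattern of C_{i_1,…,i_n} ∈ 𝒞 such that the only nonzero entries of the i_1-block of A (the submatrix of A with rows i_1,…,n and columns 1,…,i_1) are the variables x_1,…,x_n. Then A is a companion matrix if and only if: (ii) for each k = 1,…,n, A[1,…,i_k−k] is a constant nilpotent matrix or the empty matrix; and (iii) for each k = 1,…,n, A[i_k+1,…,n] is a constant nilpotent matrix or the empty matrix. -/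
open Polynomial Matrix

noncomputable section

/-- The determinant of the leading `m × m` section of an infinite array. -/
def leadDet {R : Type*} [CommRing R] (q : ℕ → ℕ → R) (m : ℕ) : R :=
  (Matrix.of fun i j : Fin m => q i j).det

lemma leadDet_zero {R : Type*} [CommRing R] (q : ℕ → ℕ → R) : leadDet q 0 = 1 :=
  Matrix.det_fin_zero

lemma leadDet_congr {R : Type*} [CommRing R] {q q' : ℕ → ℕ → R} {m : ℕ}
    (h : ∀ i < m, ∀ j < m, q i j = q' i j) : leadDet q m = leadDet q' m := by
  unfold leadDet
  congr 1
  ext i j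
  exact h i i.2 j j.2

lemma leadDet_reflect {R : Type*} [CommRing R] (q : ℕ → ℕ → R) (m : ℕ) :
    leadDet (fun i j => q (m - 1 - j) (m - 1 - i)) m = leadDet q m := by
  unfold leadDet
  rw [← Matrix.det_transpose, ← Matrix.det_submatrix_equiv_self Fin.revPerm]
  congr 1
  ext i j
  simp only [Matrix.submatrix_apply, Matrix.transpose_apply, Matrix.of_apply, Fin.revPerm_apply,
    Fin.val_rev]
  congr 1 <;> omega

/-- Expansion of the leading minors of a lower Hessenberg array with superdiagonal `-1`
along the last row. -/
lemma leadDet_succ {R : Type*} [CommRing R] (q : ℕ → ℕ → R) (m : ℕ)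
    (hone : ∀ i < m, q i (i + 1) = -1) (hzero : ∀ i j, i + 1 < j → j ≤ m → q i j = 0) :
    leadDet q (m + 1) = ∑ j ∈ Finset.range (m + 1), q m j * leadDet q j := by
  induction m using Nat.strong_induction_on with
  | _ m ih =>
  set Q : Matrix (Fin (m + 1)) (Fin (m + 1)) R := Matrix.of fun i j => q i j with hQ
  set v : Fin (m + 1) → R := fun j => leadDet q j with hv
  set t : R := ∑ j ∈ Finset.range (m + 1), q m j * leadDet q j with ht
  have hlast : (Q *ᵥ v) (Fin.last m) = t := by
    rw [ht, Finset.sum_range]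
    rfl
  have hrow : ∀ i : Fin m, (Q *ᵥ v) i.castSucc = 0 := by
    intro i
    have hsum : (Q *ᵥ v) i.castSucc = ∑ j ∈ Finset.range (m + 1), q i j * leadDet q j := by
      rw [Finset.sum_range]
      rfl
    rw [hsum, ← Finset.sum_subset (Finset.range_subset_range.2 (by omega : i.1 + 2 ≤ m + 1)),
      Finset.sum_range_succ,
      ih i i.2 (fun a ha => hone a (by omega)) (fun a b hab hb => hzero a b hab (by omega)),
      hone i i.2]
    · ring
    · intro j hj hj'
      simp only [Finset.mem_range] at hj hj'
      rw [hzero i j (by omega) (by omega), zero_mul]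
  have hcramer : (Q.updateCol 0 (Q *ᵥ v)).det = Q.det := by
    rw [← Matrix.cramer_apply, Matrix.cramer_eq_adjugate_mulVec, Matrix.mulVec_mulVec,
      Matrix.adjugate_mul, Matrix.smul_mulVec, Matrix.one_mulVec]
    simp [hv, leadDet_zero]
  have hminor : ((Q.updateCol 0 (Q *ᵥ v)).submatrix (Fin.last m).succAbove Fin.succ).det
      = (-1) ^ m := by
    rw [Matrix.det_of_isLowerTriangular]
    · simp [hQ, hone]
    · intro i j hij
      have hij' : (i : ℕ) < j := hij
      simpa [hQ] using hzero i (j + 1) (by omega) (by omega)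
  change Q.det = t
  rw [← hcramer, Matrix.det_succ_column_zero, Fin.sum_univ_castSucc, hminor]
  simp only [Matrix.updateCol_self, hrow, hlast, Fin.val_last]
  simp only [mul_zero, zero_mul, Finset.sum_const_zero, zero_add]
  rw [mul_right_comm, ← pow_add, Even.neg_one_pow ⟨m, rfl⟩, one_mul]

/-- The determinant of the section of an array on the indices `s, …, n - 1`. -/
def trailDet {R : Type*} [CommRing R] (q : ℕ → ℕ → R) (n s : ℕ) : R :=
  leadDet (fun i j => q (s + i) (s + j)) (n - s)

/-- Expansion of the trailing minors of a lower Hessenberg array with superdiagonal `-1`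
along the first column. -/
lemma trailDet_eq_sum {R : Type*} [CommRing R] (q : ℕ → ℕ → R) {n s : ℕ} (hs : s < n)
    (hone : ∀ i, i + 1 < n → q i (i + 1) = -1)
    (hzero : ∀ i j, i + 1 < j → j < n → q i j = 0) :
    trailDet q n s = ∑ i ∈ Finset.Ico s n, trailDet q n (i + 1) * q i s := by
  obtain ⟨m, rfl⟩ := Nat.exists_eq_add_of_lt hs
  have hsub : s + m + 1 - s = m + 1 := by omega
  rw [trailDet, hsub, ← leadDet_reflect, leadDet_succ, Finset.sum_Ico_eq_sum_range, hsub,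
    ← Finset.sum_range_reflect]
  · refine Finset.sum_congr rfl fun j hj => ?_
    have hj' := Finset.mem_range.1 hj
    rw [mul_comm, trailDet, ← leadDet_reflect]
    congr 1
    · rw [show s + m + 1 - (s + j + 1) = m + 1 - 1 - j by omega]
      refine leadDet_congr fun a ha b hb => ?_
      congr 1 <;> omega
    · congr 1 <;> omega
  · intro i hi
    rw [← hone (s + (m + 1 - 1 - (i + 1))) (by omega)]
    congr 1
    omega
  · intro i j hij hj
    exact hzero _ _ (by omega) (by omega)

/-- Expansion of the determinant of a lower Hessenberg array with superdiagonal `-1`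
along the block of rows `≥ p` and columns `≤ p`. -/
lemma leadDet_eq_block_sum {R : Type*} [CommRing R] (q : ℕ → ℕ → R) {n p : ℕ} (hp : p < n)
    (hone : ∀ i, i + 1 < n → q i (i + 1) = -1)
    (hzero : ∀ i j, i + 1 < j → j < n → q i j = 0) :
    leadDet q n = ∑ i ∈ Finset.Ico p n, ∑ j ∈ Finset.range (p + 1),
      trailDet q n (i + 1) * q i j * leadDet q j := by
  obtain ⟨m, rfl⟩ : ∃ m, n = m + 1 := ⟨n - 1, by omega⟩
  have hpm : p ≤ m := by omega
  clear hp
  induction hpm using Nat.decreasingInduction with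
  | self =>
    rw [leadDet_succ q m (fun i hi => hone i (by omega))
      (fun i j hij hj => hzero i j hij (by omega))]
    simp [trailDet, leadDet_zero]
  | of_succ p hp ih =>
    rw [ih, Finset.sum_eq_sum_Ico_succ_bot (by omega : p < m + 1)]
    simp_rw [mul_assoc, ← Finset.mul_sum, Finset.sum_range_succ _ (p + 1), mul_add,
      Finset.sum_add_distrib, ← mul_assoc, ← Finset.sum_mul]
    rw [← trailDet_eq_sum q (by omega) hone hzero, leadDet_succ q p
      (fun i hi => hone i (by omega)) (fun i j hij hj => hzero i j hij (by omega))]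
    ring

lemma isNilpotent_iff_charpoly_eq_X_pow {R : Type*} [CommRing R] [IsDomain R] {m : ℕ}
    (M : Matrix (Fin m) (Fin m) R) : IsNilpotent M ↔ M.charpoly = X ^ m := by
  constructor
  · intro h
    have := (Matrix.isNilpotent_charpoly_sub_pow_of_isNilpotent h).eq_zero
    rwa [Fintype.card_fin, sub_eq_zero] at this
  · intro h
    exact ⟨m, by simpa [h] using Matrix.aeval_self_charpoly M⟩

lemma eq_X_pow_of_mul_eq_X_pow {K : Type*} [Field K] {p q : K[X]} {d : ℕ}
    (hp : p.Monic) (h : p * q = X ^ d) : p = X ^ p.natDegree := by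
  obtain ⟨i, -, hi⟩ := (dvd_prime_pow prime_X d).1 ⟨q, h.symm⟩
  have h' := eq_of_monic_of_associated hp (monic_X_pow i) hi
  conv_rhs => rw [h', natDegree_X_pow]
  exact h'

/-- A matrix of constants is the image of a matrix over the base field. -/
lemma IsConstMatrix.map_constantCoeff {F : Type*} [Field F] {n m : ℕ}
    {M : Matrix (Fin m) (Fin m) (MvPolynomial (Fin n) F)} (hM : IsConstMatrix M) :
    (M.map MvPolynomial.constantCoeff).map MvPolynomial.C = M := by
  ext1 i j
  obtain ⟨c, hc⟩ := hM i j
  simp [hc]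

lemma IsConstMatrix.charpoly_eq_map {F : Type*} [Field F] {n m : ℕ}
    {M : Matrix (Fin m) (Fin m) (MvPolynomial (Fin n) F)} (hM : IsConstMatrix M) :
    M.charpoly = (M.map MvPolynomial.constantCoeff).charpoly.map MvPolynomial.C := by
  conv_lhs => rw [← hM.map_constantCoeff]
  exact Matrix.charpoly_map _ MvPolynomial.C

lemma IsConstMatrix.isNilpotent_iff {F : Type*} [Field F] {n m : ℕ}
    {M : Matrix (Fin m) (Fin m) (MvPolynomial (Fin n) F)} (hM : IsConstMatrix M) :
    IsNilpotent M ↔ (M.map MvPolynomial.constantCoeff).charpoly = X ^ m := by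
  rw [isNilpotent_iff_charpoly_eq_X_pow, hM.charpoly_eq_map,
    ← (Polynomial.map_injective _ (MvPolynomial.C_injective (Fin n) F)).eq_iff,
    Polynomial.map_pow, Polynomial.map_X]

/-- Comparison of the coefficients of the variables. -/
lemma map_sub_sum_eq_iff {F : Type*} [Field F] {n : ℕ} (f f' : F[X]) (g g' : Fin n → F[X]) :
    f.map MvPolynomial.C - ∑ k, C (MvPolynomial.X k) * (g k).map MvPolynomial.C =
      f'.map MvPolynomial.C - ∑ k, C (MvPolynomial.X k : MvPolynomial (Fin n) F) *
        (g' k).map MvPolynomial.C ↔ f = f' ∧ ∀ k, g k = g' k := by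
  constructor
  · intro h
    have hval : ∀ x : Fin n → F, f - ∑ k, C (x k) * g k = f' - ∑ k, C (x k) * g' k := by
      intro x
      have hid : (MvPolynomial.eval x).comp MvPolynomial.C = RingHom.id F := by
        ext; simp
      have := congrArg (Polynomial.map (MvPolynomial.eval x)) h
      simpa [Polynomial.map_sum, Polynomial.map_map, hid] using this
    have hf : f = f' := by simpa using hval 0
    refine ⟨hf, fun k => ?_⟩
    have := hval (Pi.single k 1)
    simpa [hf, Pi.single_apply, apply_ite C, ite_mul] using this
  · rintro ⟨rfl, h⟩
    simp [h]

/-- The entries of the characteristic matrix as an array indexed by natural numbers. -/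
def charArray {R : Type*} [CommRing R] {n : ℕ} (A : Matrix (Fin n) (Fin n) R) (i j : ℕ) : R[X] :=
  if h : i < n ∧ j < n then A.charmatrix ⟨i, h.1⟩ ⟨j, h.2⟩ else 0

lemma charArray_eq {R : Type*} [CommRing R] {n : ℕ} (A : Matrix (Fin n) (Fin n) R) {i j : ℕ}
    (hi : i < n) (hj : j < n) :
    charArray A i j = (if i = j then X else 0) - C (A ⟨i, hi⟩ ⟨j, hj⟩) := by
  rw [charArray, dif_pos ⟨hi, hj⟩]
  simp [Matrix.charmatrix_apply, Matrix.diagonal_apply]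

lemma leadDet_charArray {R : Type*} [CommRing R] {n : ℕ} (A : Matrix (Fin n) (Fin n) R) {m : ℕ}
    (h : m ≤ n) : leadDet (charArray A) m = (leadSub A m h).charpoly := by
  unfold leadDet Matrix.charpoly
  congr 1
  ext1 i j
  rw [Matrix.of_apply, charArray_eq A (by omega) (by omega)]
  simp [leadSub, Matrix.charmatrix_apply, Matrix.diagonal_apply, Fin.ext_iff, Fin.castLE]

lemma trailDet_charArray {R : Type*} [CommRing R] {n : ℕ} (A : Matrix (Fin n) (Fin n) R) {s m : ℕ}
    (hs : s + m = n) (h : m ≤ n) : trailDet (charArray A) n s = (trailSub A m h).charpoly := by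
  obtain rfl : s = n - m := by omega
  rw [trailDet, show n - (n - m) = m by omega, leadDet, Matrix.charpoly]
  congr 1
  ext1 i j
  rw [Matrix.of_apply, charArray_eq A (by omega) (by omega)]
  simp [trailSub, Matrix.charmatrix_apply, Matrix.diagonal_apply, Fin.ext_iff]

lemma CPos_injective {n : ℕ} {hn : 0 < n} {r : Fin n → Fin n} (hr : IsCIdx hn r) :
    Function.Injective (CPos r) := by
  intro k l h
  simp only [CPos, Prod.mk.injEq, Fin.ext_iff] at h
  have hk := hr k
  have hl := hr l
  ext
  omega

lemma CMat_apply_of_le {F : Type*} [Field F] {n : ℕ} (r : Fin n → Fin n) {i j : Fin n}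
    (h : (j : ℕ) ≤ i) :
    CMat F r i j = ∑ k, if CPos r k = (i, j) then MvPolynomial.X k else 0 := by
  simp only [CMat, HMat]
  rw [if_neg (by omega), zero_add]

lemma CMat_apply_CPos {F : Type*} [Field F] {n : ℕ} {hn : 0 < n} {r : Fin n → Fin n}
    (hr : IsCIdx hn r) (k : Fin n) :
    CMat F r (CPos r k).1 (CPos r k).2 = MvPolynomial.X k := by
  rw [CMat_apply_of_le r (Nat.sub_le _ _)]
  simp [(CPos_injective hr).eq_iff]

lemma IsULHSuperpatternOf.apply_CPos {F : Type*} [Field F] {n : ℕ} {hn : 0 < n}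
    {r : Fin n → Fin n} (hr : IsCIdx hn r) {A : Matrix (Fin n) (Fin n) (MvPolynomial (Fin n) F)}
    (hA : IsULHSuperpatternOf A (CMat F r)) (k : Fin n) :
    A (CPos r k).1 (CPos r k).2 = MvPolynomial.X k := by
  rcases hA.2 (CPos r k).1 (CPos r k).2 (Nat.sub_le _ _) with h | ⟨h, -⟩
  · rw [h, CMat_apply_CPos hr]
  · rw [CMat_apply_CPos hr] at h
    exact absurd h (MvPolynomial.X_ne_zero k)

lemma IsULHSuperpatternOf.exists_eq_C {F : Type*} [Field F] {n : ℕ} {r : Fin n → Fin n}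
    {A : Matrix (Fin n) (Fin n) (MvPolynomial (Fin n) F)}
    (hA : IsULHSuperpatternOf A (CMat F r)) {i j : Fin n} (h : ∀ k, CPos r k ≠ (i, j)) :
    ∃ c : F, A i j = MvPolynomial.C c := by
  have hC : ∃ c : F, CMat F r i j = MvPolynomial.C c := by
    refine ⟨if (j : ℕ) = (i : ℕ) + 1 then 1 else 0, ?_⟩
    simp [CMat, HMat, h, apply_ite MvPolynomial.C]
  rcases lt_or_ge (i : ℕ) (j : ℕ) with hij | hij
  · rwa [hA.1 i j hij]
  · rcases hA.2 i j hij with h' | ⟨-, c, -, hc⟩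
    · rwa [h']
    · exact ⟨c, hc⟩

lemma IsULHSuperpatternOf.isULH {F : Type*} [Field F] {n : ℕ} {r : Fin n → Fin n}
    {A : Matrix (Fin n) (Fin n) (MvPolynomial (Fin n) F)}
    (hA : IsULHSuperpatternOf A (CMat F r)) : IsULH A := by
  have hpos : ∀ i j : Fin n, (i : ℕ) < j → ∀ k, CPos r k ≠ (i, j) := by
    rintro i j hij k h
    simp only [CPos, Prod.mk.injEq, Fin.ext_iff] at h
    omega
  refine ⟨fun i j hij => ?_, fun i j hij => ?_⟩
  · rw [hA.1 i j (by omega)]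
    simp [CMat, HMat, hpos i j (by omega), hij]
  · rw [hA.1 i j (by omega)]
    simp [CMat, HMat, hpos i j (by omega), hij.ne']

lemma IsULHSuperpatternOf.apply_block {F : Type*} [Field F] {n : ℕ} {hn : 0 < n}
    {r : Fin n → Fin n} (hr : IsCIdx hn r) {A : Matrix (Fin n) (Fin n) (MvPolynomial (Fin n) F)}
    (hA : IsULHSuperpatternOf A (CMat F r))
    (hblock : ∀ i j : Fin n, (r ⟨0, hn⟩ : ℕ) ≤ (i : ℕ) → (j : ℕ) ≤ (r ⟨0, hn⟩ : ℕ) →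
      A i j ≠ 0 → ∃ k : Fin n, CPos r k = (i, j))
    {i j : Fin n} (hi : (r ⟨0, hn⟩ : ℕ) ≤ i) (hj : (j : ℕ) ≤ r ⟨0, hn⟩) :
    A i j = ∑ k, if CPos r k = (i, j) then MvPolynomial.X k else 0 := by
  by_cases h : ∃ k, CPos r k = (i, j)
  · obtain ⟨k, hk⟩ := h
    have := hA.apply_CPos hr k
    rw [hk] at this
    rw [this, ← hk]
    simp [(CPos_injective hr).eq_iff]
  · rw [by_contra fun h0 => h (hblock i j hi hj h0)]
    simp only [not_exists] at h
    simp [h]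

/-- The characteristic polynomial of a superpattern whose block contains only the variables. -/
lemma charpoly_eq_of_block {F : Type*} [Field F] {n : ℕ} {hn : 0 < n}
    {r : Fin n → Fin n} (hr : IsCIdx hn r) {A : Matrix (Fin n) (Fin n) (MvPolynomial (Fin n) F)}
    (hA : IsULHSuperpatternOf A (CMat F r))
    (hblock : ∀ i j : Fin n, (r ⟨0, hn⟩ : ℕ) ≤ (i : ℕ) → (j : ℕ) ≤ (r ⟨0, hn⟩ : ℕ) →
      A i j ≠ 0 → ∃ k : Fin n, CPos r k = (i, j)) :
    A.charpoly = X * (trailDet (charArray A) n (r ⟨0, hn⟩ + 1) *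
        leadDet (charArray A) (r ⟨0, hn⟩)) -
      ∑ k, C (MvPolynomial.X k) * (trailDet (charArray A) n (r k + 1) *
        leadDet (charArray A) (r k - k)) := by
  set p : ℕ := (r ⟨0, hn⟩ : ℕ) with hp
  have hpn : p < n := (r ⟨0, hn⟩).2
  have hlead : A.charpoly = leadDet (charArray A) n := by
    rw [leadDet_charArray A le_rfl]
    rfl
  rw [hlead, leadDet_eq_block_sum (charArray A) hpn]
  · have hentry : ∀ i ∈ Finset.Ico p n, ∀ j ∈ Finset.range (p + 1),
        trailDet (charArray A) n (i + 1) * charArray A i j * leadDet (charArray A) j =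
        (if i = p then if j = p then X * (trailDet (charArray A) n (i + 1) *
          leadDet (charArray A) j) else 0 else 0) -
        ∑ k : Fin n, if (r k : ℕ) = i then if (r k : ℕ) - k = j then
          C (MvPolynomial.X k) * (trailDet (charArray A) n (i + 1) *
          leadDet (charArray A) j) else 0 else 0 := by
      intro i hi j hj
      rw [Finset.mem_Ico] at hi
      rw [Finset.mem_range] at hj
      rw [charArray_eq A hi.2 (by omega), hA.apply_block hr hblock hi.1 (by simp; omega), map_sum,
        mul_sub, sub_mul, Finset.mul_sum, Finset.sum_mul]
      congr 1
      · split_ifs <;> first | omega | ring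
      · refine Finset.sum_congr rfl fun k _ => ?_
        simp only [CPos, Prod.mk.injEq, Fin.ext_iff, ite_and]
        split_ifs <;> first | ring1 | simp
    rw [Finset.sum_congr rfl fun i hi => Finset.sum_congr rfl (hentry i hi)]
    simp_rw [Finset.sum_sub_distrib]
    congr 1
    · rw [Finset.sum_eq_single_of_mem p (Finset.mem_Ico.2 ⟨le_rfl, hpn⟩),
        Finset.sum_eq_single_of_mem p (Finset.self_mem_range_succ p)]
      · simp
      · intro j _ hj
        simp [hj]
      · intro i _ hi
        simp [hi]
    · simp_rw [Finset.sum_comm (s := Finset.range (p + 1))]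
      rw [Finset.sum_comm]
      refine Finset.sum_congr rfl fun k _ => ?_
      rw [Finset.sum_eq_single_of_mem (r k : ℕ) (Finset.mem_Ico.2 ⟨(hr k).2.2, (r k).2⟩),
        Finset.sum_eq_single_of_mem ((r k : ℕ) - k)
          (Finset.mem_range.2 (Nat.lt_succ_of_le (hr k).2.1))]
      · simp
      · intro j _ hj
        simp [hj.symm]
      · intro i _ hi
        simp [hi.symm]
  · intro i hi
    rw [charArray_eq A (by omega) hi, if_neg (by omega), hA.isULH.1 _ _ rfl]
    simp
  · intro i j hij hj
    rw [charArray_eq A (by omega) hj, if_neg (by omega), hA.isULH.2 _ _ hij]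
    simp

/-- If the only nonzero entries of the `i₁`-block of a ULH
superpattern `A` of `C_{i₁,…,iₙ} ∈ 𝒞` are the variables `x₁,…,xₙ`, then `A` is a
companion matrix iff each `A[1,…,iₖ−k]` and each `A[iₖ+1,…,n]` is a constant
nilpotent matrix or empty. -/
theorem superpattern_isCompanion_iff_of_block {F : Type*} [Field F] {n : ℕ} (hn : 0 < n)
    (r : Fin n → Fin n) (hr : IsCIdx hn r)
    (A : Matrix (Fin n) (Fin n) (MvPolynomial (Fin n) F))
    (hA : IsULHSuperpatternOf A (CMat F r))
    (hblock : ∀ i j : Fin n, (r ⟨0, hn⟩ : ℕ) ≤ (i : ℕ) → (j : ℕ) ≤ (r ⟨0, hn⟩ : ℕ) →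
      A i j ≠ 0 → ∃ k : Fin n, CPos r k = (i, j)) :
    IsCompanion A ↔
      ((∀ k : Fin n,
        IsConstMatrix (leadSub A ((r k : ℕ) - (k : ℕ)) (le_trans (Nat.sub_le _ _) (r k).isLt.le)) ∧
        IsNilpotent (leadSub A ((r k : ℕ) - (k : ℕ)) (le_trans (Nat.sub_le _ _) (r k).isLt.le))) ∧
      (∀ k : Fin n,
        IsConstMatrix (trailSub A (n - 1 - (r k : ℕ)) (by omega)) ∧
        IsNilpotent (trailSub A (n - 1 - (r k : ℕ)) (by omega)))) := by
  have hposC : (∃ pos : Fin n → Fin n × Fin n, Function.Injective pos ∧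
      (∀ k : Fin n, A (pos k).1 (pos k).2 = MvPolynomial.X k) ∧
      (∀ i j : Fin n, (∀ k, pos k ≠ (i, j)) → ∃ c : F, A i j = MvPolynomial.C c)) :=
    ⟨CPos r, CPos_injective hr, hA.apply_CPos hr, fun i j => hA.exists_eq_C⟩
  have hconstL (k : Fin n) : IsConstMatrix (leadSub A ((r k : ℕ) - (k : ℕ))
      (le_trans (Nat.sub_le _ _) (r k).isLt.le)) := by
    intro i j
    refine hA.exists_eq_C fun l h => ?_
    have hi := i.2
    have hk := hr k
    have hl := hr l
    simp only [CPos, Prod.mk.injEq, Fin.ext_iff, Fin.val_castLE] at h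
    omega
  have hconstT (k : Fin n) : IsConstMatrix (trailSub A (n - 1 - (r k : ℕ)) (by omega)) := by
    intro i j
    refine hA.exists_eq_C fun l h => ?_
    have hj := j.2
    have hk := hr k
    have hl := hr l
    simp only [CPos, Prod.mk.injEq, Fin.ext_iff] at h
    omega
  set p : Fin n → F[X] := fun k => ((leadSub A ((r k : ℕ) - (k : ℕ))
    (le_trans (Nat.sub_le _ _) (r k).isLt.le)).map MvPolynomial.constantCoeff).charpoly with hp
  set t : Fin n → F[X] := fun k => ((trailSub A (n - 1 - (r k : ℕ))
    (by omega)).map MvPolynomial.constantCoeff).charpoly with ht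
  have hpL (k : Fin n) : leadDet (charArray A) (r k - k) = (p k).map MvPolynomial.C := by
    rw [leadDet_charArray A ((Nat.sub_le _ _).trans (r k).isLt.le),
      (hconstL k).charpoly_eq_map]
  have htT (k : Fin n) : trailDet (charArray A) n (r k + 1) = (t k).map MvPolynomial.C := by
    rw [trailDet_charArray A (m := n - 1 - r k) (by omega) (by omega),
      (hconstT k).charpoly_eq_map]
  have hpM (k : Fin n) : (p k).Monic := Matrix.charpoly_monic _
  have htM (k : Fin n) : (t k).Monic := Matrix.charpoly_monic _
  have hpD (k : Fin n) : (p k).natDegree = r k - k := by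
    simp [hp, Matrix.charpoly_natDegree_eq_dim]
  have htD (k : Fin n) : (t k).natDegree = n - 1 - r k := by
    simp [ht, Matrix.charpoly_natDegree_eq_dim]
  have hchar : A.charpoly = (X * (t ⟨0, hn⟩ * p ⟨0, hn⟩)).map MvPolynomial.C -
      ∑ k, C (MvPolynomial.X k) * (t k * p k).map MvPolynomial.C := by
    rw [charpoly_eq_of_block hr hA hblock]
    simp only [Polynomial.map_mul, Polynomial.map_X, ← hpL, ← htT, Nat.sub_zero]
  have hgoal : (X : (MvPolynomial (Fin n) F)[X]) ^ n -
      ∑ k : Fin n, C (MvPolynomial.X k) * X ^ (n - 1 - (k : ℕ)) =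
      (X ^ n : F[X]).map MvPolynomial.C - ∑ k : Fin n, C (MvPolynomial.X k) *
        (X ^ (n - 1 - (k : ℕ)) : F[X]).map MvPolynomial.C := by
    simp
  rw [IsCompanion, and_iff_right hposC, hchar, hgoal, map_sub_sum_eq_iff]
  simp only [hconstL, hconstT, true_and, (hconstL _).isNilpotent_iff, (hconstT _).isNilpotent_iff]
  change _ ↔ (∀ k, p k = X ^ ((r k : ℕ) - k)) ∧ ∀ k, t k = X ^ (n - 1 - (r k : ℕ))
  constructor
  · rintro ⟨-, h⟩
    refine ⟨fun k => ?_, fun k => ?_⟩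
    · rw [← hpD k]
      exact eq_X_pow_of_mul_eq_X_pow (hpM k) ((mul_comm _ _).trans (h k))
    · rw [← htD k]
      exact eq_X_pow_of_mul_eq_X_pow (htM k) (h k)
  · rintro ⟨h₁, h₂⟩
    have h (k : Fin n) : t k * p k = X ^ (n - 1 - (k : ℕ)) := by
      have := (hr k).1
      rw [h₁, h₂, ← pow_add]
      congr 1
      omega
    refine ⟨?_, h⟩
    rw [h, ← pow_succ']
    congr 1
    simp only
    omega
end
end

section
/- For every n ≥ 1, 𝔑^n_L(1,2,…,n) = {U_n} and 𝔑^n_T(1,2,…,n) = {U_n}: the upper shift matrix U_n is the unique constant ULH matrix of order n all of whose leading (respectively, trailing) principal submatrices of orders 1,…,n are nilpotent. -/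
open Polynomial Matrix

noncomputable section

lemma Matrix.pow_card_eq_zero_of_isNilpotent {ι R : Type*} [Fintype ι] [DecidableEq ι]
    [CommRing R] [IsDomain R] {M : Matrix ι ι R} (hM : IsNilpotent M) :
    M ^ Fintype.card ι = 0 := by
  have h : M.charpoly = X ^ Fintype.card ι :=
    sub_eq_zero.mp (isNilpotent_charpoly_sub_pow_of_isNilpotent hM).eq_zero
  simpa [h] using M.aeval_self_charpoly

/-- The reflection of a square matrix across its antidiagonal. -/
def antiTranspose {R : Type*} {m : ℕ} (M : Matrix (Fin m) (Fin m) R) :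
    Matrix (Fin m) (Fin m) R :=
  (M.submatrix Fin.rev Fin.rev)ᵀ

lemma antiTranspose_antiTranspose {R : Type*} {m : ℕ} (M : Matrix (Fin m) (Fin m) R) :
    antiTranspose (antiTranspose M) = M := by
  ext i j
  simp [antiTranspose]

lemma antiTranspose_Ushift {R : Type*} [Zero R] [One R] (m : ℕ) :
    antiTranspose (Ushift R m) = Ushift R m := by
  ext i j
  simp only [antiTranspose, Ushift, transpose_apply, submatrix_apply, Fin.val_rev]
  congr 1
  exact propext (by omega)

lemma IsNilpotent.antiTranspose {R : Type*} [CommRing R] {m : ℕ}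
    {M : Matrix (Fin m) (Fin m) R} (hM : IsNilpotent M) :
    IsNilpotent (antiTranspose M) :=
  Matrix.isNilpotent_transpose_iff.mpr (hM.map (reindexAlgEquiv R R Fin.revPerm))

lemma leadSub_antiTranspose {R : Type*} {n m : ℕ} (A : Matrix (Fin n) (Fin n) R) (h : m ≤ n) :
    leadSub (antiTranspose A) m h = antiTranspose (trailSub A m h) := by
  ext i j
  simp only [antiTranspose, leadSub, trailSub, transpose_apply, submatrix_apply]
  congr 1 <;> ext <;> simp only [Fin.val_rev, Fin.val_castLE] <;> omega

lemma trailSub_antiTranspose {R : Type*} {n m : ℕ} (A : Matrix (Fin n) (Fin n) R) (h : m ≤ n) :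
    trailSub (antiTranspose A) m h = antiTranspose (leadSub A m h) := by
  conv_rhs => rw [← antiTranspose_antiTranspose A, leadSub_antiTranspose,
    antiTranspose_antiTranspose]

lemma IsULH.antiTranspose {R : Type*} [Zero R] [One R] {m : ℕ} {A : Matrix (Fin m) (Fin m) R}
    (hA : IsULH A) : IsULH (antiTranspose A) :=
  ⟨fun i j h => hA.1 _ _ (by simp only [Fin.val_rev]; omega),
    fun i j h => hA.2 _ _ (by simp only [Fin.val_rev]; omega)⟩

lemma isULH_Ushift (R : Type*) [Zero R] [One R] (m : ℕ) : IsULH (Ushift R m) :=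
  ⟨fun _ _ h => if_pos h, fun _ _ h => if_neg h.ne'⟩

lemma leadSub_Ushift {R : Type*} [Zero R] [One R] {n m : ℕ} (h : m ≤ n) :
    leadSub (Ushift R n) m h = Ushift R m :=
  rfl

lemma Ushift_pow_apply {R : Type*} [Semiring R] {m : ℕ} (k : ℕ) (i j : Fin m) :
    (Ushift R m ^ k) i j = if (j : ℕ) = i + k then 1 else 0 := by
  induction k generalizing j with
  | zero => simp [Matrix.one_apply, Fin.ext_iff, eq_comm]
  | succ k ih =>
    simp only [pow_succ, Matrix.mul_apply, ih, ite_mul, one_mul, zero_mul, Ushift]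
    by_cases hk : (i : ℕ) + k < m
    · rw [Finset.sum_eq_single ⟨i + k, hk⟩ (fun l _ hl => if_neg fun h => hl (Fin.ext h))
        (by simp)]
      simp [add_assoc]
    · rw [if_neg (by omega)]
      exact Finset.sum_eq_zero fun l _ => if_neg (by omega)

lemma isNilpotent_Ushift (R : Type*) [Semiring R] (m : ℕ) : IsNilpotent (Ushift R m) :=
  ⟨m, by ext i j; rw [Ushift_pow_apply, if_neg (by omega), Matrix.zero_apply]⟩

/-- If all rows of `M` but the last agree with those of the upper shift matrix, then the first
row of `M ^ k` is the `k`-th standard basis vector for every `k` below the order of `M`. -/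
lemma pow_apply_zero_of_rows_eq_Ushift {R : Type*} [Semiring R] {m : ℕ}
    {M : Matrix (Fin (m + 1)) (Fin (m + 1)) R}
    (hM : ∀ i j : Fin (m + 1), (i : ℕ) < m → M i j = Ushift R (m + 1) i j)
    {k : ℕ} (hk : k ≤ m) (j : Fin (m + 1)) :
    (M ^ k) 0 j = if (j : ℕ) = k then 1 else 0 := by
  induction k generalizing j with
  | zero =>
    rw [pow_zero, Matrix.one_apply]
    exact if_congr (by rw [Fin.ext_iff, Fin.val_zero, eq_comm]) rfl rfl
  | succ k ih =>
    simp only [pow_succ, Matrix.mul_apply, ih (by omega), ite_mul, one_mul, zero_mul]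
    rw [Finset.sum_eq_single ⟨k, by omega⟩ (fun l _ hl => if_neg fun h => hl (Fin.ext h))
      (by simp), if_pos rfl, hM _ _ (by simp; omega), Ushift]

lemma last_row_eq_zero_of_isNilpotent {R : Type*} [CommRing R] [IsDomain R] {m : ℕ}
    {M : Matrix (Fin (m + 1)) (Fin (m + 1)) R}
    (hM : ∀ i j : Fin (m + 1), (i : ℕ) < m → M i j = Ushift R (m + 1) i j)
    (hnil : IsNilpotent M) (j : Fin (m + 1)) : M (Fin.last m) j = 0 := by
  have h : (M ^ (m + 1)) 0 j = 0 := by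
    simpa using congr_fun₂ (Matrix.pow_card_eq_zero_of_isNilpotent hnil) 0 j
  simp only [pow_succ, Matrix.mul_apply, pow_apply_zero_of_rows_eq_Ushift hM le_rfl, ite_mul,
    one_mul, zero_mul] at h
  rwa [Finset.sum_eq_single (Fin.last m) (fun l _ hl => if_neg fun hlm : (l : ℕ) = m =>
    hl (Fin.ext hlm)) (by simp), if_pos (Fin.val_last m)] at h

lemma eq_Ushift_of_isNilpotent_leadSub {R : Type*} [CommRing R] [IsDomain R] {n : ℕ}
    {A : Matrix (Fin n) (Fin n) R} (hA : IsULH A)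
    (hnil : ∀ (m : ℕ) (h : m ≤ n), m ≠ 0 → IsNilpotent (leadSub A m h)) :
    A = Ushift R n := by
  suffices H : ∀ (k : ℕ) (i j : Fin n), (i : ℕ) = k → A i j = Ushift R n i j from
    Matrix.ext fun i j => H i i j rfl
  intro k
  induction k using Nat.strong_induction_on with
  | _ k ih =>
    rintro i j rfl
    rcases lt_or_ge (i : ℕ) j with hij | hij
    · rcases (Nat.succ_le_of_lt hij).eq_or_lt with h | h
      · rw [hA.1 i j h.symm, (isULH_Ushift R n).1 i j h.symm]
      · rw [hA.2 i j h, (isULH_Ushift R n).2 i j h]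
    · rw [Ushift, if_neg (by omega)]
      exact last_row_eq_zero_of_isNilpotent (fun a b ha => ih a ha _ _ rfl)
        (hnil (i + 1) i.isLt (Nat.succ_ne_zero _)) ⟨j, Nat.lt_succ_of_le hij⟩

lemma isULH_and_isNilpotent_leadSub_iff {R : Type*} [CommRing R] [IsDomain R] {n : ℕ}
    {A : Matrix (Fin n) (Fin n) R} :
    (IsULH A ∧ ∀ (m : ℕ) (h : m ≤ n), m ≠ 0 → IsNilpotent (leadSub A m h)) ↔
      A = Ushift R n := by
  refine ⟨fun h => eq_Ushift_of_isNilpotent_leadSub h.1 h.2, ?_⟩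
  rintro rfl
  exact ⟨isULH_Ushift R n, fun m _ _ => isNilpotent_Ushift R m⟩

/-- `𝔑ⁿ_L(1,…,n) = {Uₙ} = 𝔑ⁿ_T(1,…,n)`: the upper shift matrix is
the unique constant ULH matrix of order `n` all of whose leading (resp. trailing)
principal submatrices of orders `1,…,n` are nilpotent. -/
theorem nested_nilpotent_eq_upperShift {F : Type*} [Field F] {n : ℕ} (hn : 0 < n)
    (A : Matrix (Fin n) (Fin n) F) :
    ((IsULH A ∧ ∀ (m : ℕ) (h : m ≤ n), m ≠ 0 → IsNilpotent (leadSub A m h)) ↔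
      A = Ushift F n) ∧
    ((IsULH A ∧ ∀ (m : ℕ) (h : m ≤ n), m ≠ 0 → IsNilpotent (trailSub A m h)) ↔
      A = Ushift F n) := by
  refine ⟨isULH_and_isNilpotent_leadSub_iff, ?_, ?_⟩
  · rintro ⟨hA, hnil⟩
    rw [← antiTranspose_antiTranspose A, ← antiTranspose_Ushift]
    refine congr_arg antiTranspose (eq_Ushift_of_isNilpotent_leadSub hA.antiTranspose ?_)
    intro m h hm
    rw [leadSub_antiTranspose]
    exact (hnil m h hm).antiTranspose
  · rintro rfl
    refine ⟨isULH_Ushift F n, fun m h _ => ?_⟩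
    rw [← antiTranspose_Ushift, trailSub_antiTranspose, leadSub_Ushift]
    exact (isNilpotent_Ushift F m).antiTranspose
end
end

section
/- A matrix A ∈ Ĉ is a companion matrix if and only if s_{k−1}(A) = x_k for every k = 1,…,n, where s_{k−1}(A) is the sum of the entries on the (k−1)-subdiagonal of A. -/
open Polynomial Matrix

noncomputable section

theorem Matrix.det_updateCol_mulVec {R m : Type*} [CommRing R] [Fintype m] [DecidableEq m]
    (M : Matrix m m R) (t : m) (v : m → R) :
    (M.updateCol t (M *ᵥ v)).det = v t * M.det := by
  rw [← cramer_apply, cramer_eq_adjugate_mulVec, mulVec_mulVec, adjugate_mul, smul_mulVec,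
    one_mulVec, Pi.smul_apply, smul_eq_mul, mul_comm]

theorem Matrix.det_updateRow_vecMul {R m : Type*} [CommRing R] [Fintype m] [DecidableEq m]
    (M : Matrix m m R) (t : m) (u : m → R) :
    (M.updateRow t (u ᵥ* M)).det = u t * M.det := by
  rw [← det_transpose, ← updateCol_transpose, ← mulVec_transpose, det_updateCol_mulVec,
    det_transpose]

/-- A matrix which is triangular with respect to an injective labelling of its indices has the
product of its diagonal entries as determinant. -/
theorem Matrix.BlockTriangular.det_of_injective {R m α : Type*} [CommRing R] [Fintype m]
    [DecidableEq m] [LinearOrder α] {M : Matrix m m R} {b : m → α} (h : M.BlockTriangular b)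
    (hb : Function.Injective b) : M.det = ∏ i, M i i := by
  rw [h.det, Finset.prod_image hb.injOn]
  refine Finset.prod_congr rfl fun i _ => ?_
  have : Unique {a // b a = b i} := ⟨⟨⟨i, rfl⟩⟩, fun a => Subtype.ext (hb a.2)⟩
  rw [det_unique]
  simp only [toSquareBlock_def, of_apply, hb (default : {a // b a = b i}).2]

/-- For a matrix whose entries on and below the diagonal are supported in the rows `≥ t` and
columns `≤ t`, the generating function of the subdiagonal sums is a bilinear form in truncated
vectors of powers of `X`. -/
theorem sum_mul_C_mul_of_block {R : Type*} [CommRing R] {n : ℕ} {A : Matrix (Fin n) (Fin n) R}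
    (t : Fin n) (hblock : ∀ i j : Fin n, j ≤ i → ¬(t ≤ i ∧ j ≤ t) → A i j = 0) :
    ∑ i : Fin n, ∑ j : Fin n, (if t ≤ i then (X : R[X]) ^ (n - 1 - (i : ℕ)) else 0) *
        (C (A i j) * (if j ≤ t then X ^ (j : ℕ) else 0)) =
      ∑ k : Fin n,
        C (∑ i : Fin n, ∑ j : Fin n, if (i : ℕ) = (j : ℕ) + k then A i j else 0) *
          X ^ (n - 1 - (k : ℕ)) := by
  have hsum : ∀ i j : Fin n,
      (if t ≤ i then (X : R[X]) ^ (n - 1 - (i : ℕ)) else 0) *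
        (C (A i j) * (if j ≤ t then X ^ (j : ℕ) else 0)) =
      ∑ k : Fin n, C (if (i : ℕ) = (j : ℕ) + k then A i j else 0) * X ^ (n - 1 - (k : ℕ)) := by
    intro i j
    by_cases hji : j ≤ i
    · have hji' : (j : ℕ) ≤ i := hji
      have hk : (i : ℕ) - j < n := by have := i.isLt; omega
      rw [Finset.sum_eq_single (⟨i - j, hk⟩ : Fin n)]
      · by_cases hb : t ≤ i ∧ j ≤ t
        · have he : n - 1 - ((i : ℕ) - j) = n - 1 - i + j := by have := i.isLt; omega
          have he' : (i : ℕ) = j + (i - j) := by omega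
          simp only [hb.1, hb.2, if_true, he, pow_add, if_pos he']
          ring
        · simp [hblock i j hji hb]
      · intro k _ hk'
        rw [if_neg, C_0, zero_mul]
        intro h
        exact hk' (Fin.ext (by simp only; omega))
      · simp
    · have hji' : ¬ (j : ℕ) ≤ i := hji
      rw [Finset.sum_eq_zero (s := Finset.univ)]
      · by_cases h : t ≤ i
        · have : ¬ j ≤ t := fun h' => hji (h'.trans h)
          simp [this]
        · simp [h]
      · intro k _
        rw [if_neg (by omega), C_0, zero_mul]
  simp only [hsum, map_sum, Finset.sum_mul]
  rw [Finset.sum_congr rfl fun i _ => Finset.sum_comm, Finset.sum_comm]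

/-- If the entries of a ULH matrix on and below the diagonal are supported in the rows `≥ t` and
columns `≤ t`, its characteristic polynomial is given by the sums along the subdiagonals. -/
theorem IsULH.charpoly_eq {R : Type*} [CommRing R] {n : ℕ} {A : Matrix (Fin n) (Fin n) R}
    (hA : IsULH A) (t : Fin n)
    (hblock : ∀ i j : Fin n, j ≤ i → ¬(t ≤ i ∧ j ≤ t) → A i j = 0) :
    A.charpoly = X ^ n - ∑ k : Fin n,
      C (∑ i : Fin n, ∑ j : Fin n, if (i : ℕ) = (j : ℕ) + k then A i j else 0) *
        X ^ (n - 1 - (k : ℕ)) := by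
  set p : R[X] := X ^ n - ∑ k : Fin n,
      C (∑ i : Fin n, ∑ j : Fin n, if (i : ℕ) = (j : ℕ) + k then A i j else 0) *
        X ^ (n - 1 - (k : ℕ)) with hp
  let v : Fin n → R[X] := fun j => if j ≤ t then X ^ (j : ℕ) else 0
  let u : Fin n → R[X] := fun i => if t ≤ i then X ^ (n - 1 - (i : ℕ)) else 0
  have hshift : ∀ i j : Fin n, ¬(t ≤ i ∧ j ≤ t) →
      A i j = if (j : ℕ) = (i : ℕ) + 1 then 1 else 0 := by
    intro i j hij
    split_ifs with h
    · exact hA.1 i j h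
    · by_cases hji : j ≤ i
      · exact hblock i j hji hij
      · exact hA.2 i j (by rw [Fin.le_def] at hji; omega)
  have hM : ∀ i j : Fin n, A.charmatrix i j = (if i = j then X else 0) - C (A i j) := by
    intro i j
    rw [charmatrix_apply, diagonal_apply]
  have hv : ∀ i, i < t → (A.charmatrix *ᵥ v) i = 0 := by
    intro i hi
    have hit : (i : ℕ) + 1 < n := by have := t.isLt; rw [Fin.lt_def] at hi; omega
    have h1 : ∀ j : Fin n, A.charmatrix i j * v j =
        (if i = j then X * v j else 0) - (if j = ⟨i + 1, hit⟩ then v j else 0) := by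
      intro j
      rw [hM, hshift i j (fun h => absurd h.1 (not_le.2 hi)), sub_mul]
      simp only [Fin.ext_iff]
      split_ifs <;> simp
    have h2 : (⟨i + 1, hit⟩ : Fin n) ≤ t := by rw [Fin.le_def]; exact hi
    simp only [mulVec, dotProduct, h1, Finset.sum_sub_distrib, Finset.sum_ite_eq,
      Finset.sum_ite_eq', Finset.mem_univ, if_true]
    simp [v, h2, hi.le, pow_succ']
  have hu : ∀ j, t < j → (u ᵥ* A.charmatrix) j = 0 := by
    intro j hj
    have hj' : (t : ℕ) < j := hj
    have hjn : (j : ℕ) - 1 < n := by have := j.isLt; omega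
    have h1 : ∀ i : Fin n, u i * A.charmatrix i j =
        (if i = j then u i * X else 0) - (if i = ⟨j - 1, hjn⟩ then u i else 0) := by
      intro i
      have h3 : ((j : ℕ) = i + 1) = (i = ⟨j - 1, hjn⟩) := by
        rw [Fin.ext_iff]; apply propext; simp only; omega
      rw [hM, hshift i j (fun h => absurd h.2 (not_le.2 hj)), mul_sub]
      simp only [h3]
      split_ifs <;> simp
    have h2 : t ≤ (⟨j - 1, hjn⟩ : Fin n) := by rw [Fin.le_def]; simp only; omega
    simp only [vecMul, dotProduct, h1, Finset.sum_sub_distrib, Finset.sum_ite_eq',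
      Finset.mem_univ, if_true]
    have h3 : n - 1 - ((j : ℕ) - 1) = n - 1 - j + 1 := by have := j.isLt; omega
    simp [u, h2, hj.le, h3, pow_succ]
  have huv : u ⬝ᵥ (A.charmatrix *ᵥ v) = p := by
    have hdiag : ∀ i : Fin n, u i * (X * v i) = if i = t then X ^ n else 0 := by
      intro i
      split_ifs with h
      · subst h
        have : n = n - 1 - (i : ℕ) + (1 + i) := by have := i.isLt; omega
        simp only [u, v, le_refl, if_true]
        conv_rhs => rw [this]
        ring
      · by_cases h1 : t ≤ i
        · have : ¬ i ≤ t := fun h2 => h (le_antisymm h2 h1)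
          simp [v, this]
        · simp [u, h1]
    have hMv : ∀ i, (A.charmatrix *ᵥ v) i = X * v i - ∑ j, C (A i j) * v j := by
      intro i
      simp [mulVec, dotProduct, hM, sub_mul, Finset.sum_sub_distrib, ite_mul]
    simp only [dotProduct, hMv, mul_sub, Finset.sum_sub_distrib, hdiag, Finset.mul_sum,
      Finset.sum_ite_eq', Finset.mem_univ, if_true]
    rw [hp, ← sum_mul_C_mul_of_block t hblock]
  set M₁ := A.charmatrix.updateCol t (A.charmatrix *ᵥ v) with hM₁
  set M₂ := M₁.updateRow t (u ᵥ* M₁) with hM₂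
  have hut : u t = X ^ (n - 1 - (t : ℕ)) := by simp [u]
  have hvt : v t = X ^ (t : ℕ) := by simp [v]
  have hdet : M₂.det = X ^ (n - 1) * A.charpoly := by
    rw [hM₂, det_updateRow_vecMul, hM₁, det_updateCol_mulVec, ← mul_assoc, hut, hvt, ← pow_add,
      Nat.sub_add_cancel (by have := t.isLt; omega), Matrix.charpoly]
  have hM₂_of_ne : ∀ i j, i ≠ t → j ≠ t → M₂ i j = A.charmatrix i j := by
    intro i j hi hj
    rw [hM₂, updateRow_ne hi, hM₁, updateCol_ne hj]
  have hM₂_col : ∀ i, i ≠ t → M₂ i t = (A.charmatrix *ᵥ v) i := by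
    intro i hi
    rw [hM₂, updateRow_ne hi, hM₁, updateCol_self]
  have hM₂_row : ∀ j, j ≠ t → M₂ t j = (u ᵥ* A.charmatrix) j := by
    intro j hj
    rw [hM₂, updateRow_self]
    simp only [vecMul, hM₁]
    congr 1
    ext1 i
    exact updateCol_ne hj
  have hM₂_self : M₂ t t = p := by
    rw [hM₂, updateRow_self, ← huv]
    simp [vecMul, dotProduct, hM₁]
  let b : Fin n → ℕ := fun i => if t < i then i else if i = t then n else n + 1 + i
  have hb : Function.Injective b := by
    intro i j hij
    simp only [b, Fin.lt_def, Fin.ext_iff] at hij ⊢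
    have := i.isLt
    have := j.isLt
    split_ifs at hij <;> omega
  have htri : M₂.BlockTriangular b := by
    intro i j hij
    have hin := i.isLt
    have hjn := j.isLt
    simp only [b, Fin.lt_def, Fin.ext_iff] at hij
    by_cases hi : i = t
    · subst hi
      have hj : i < j := by rw [Fin.lt_def]; split_ifs at hij <;> omega
      rw [hM₂_row j hj.ne', hu j hj]
    · have hi' : (i : ℕ) ≠ t := fun h => hi (Fin.ext h)
      by_cases hj : j = t
      · subst hj
        rw [hM₂_col i hi, hv i]
        rw [Fin.lt_def]; split_ifs at hij <;> omega
      · have hj' : (j : ℕ) ≠ t := fun h => hj (Fin.ext h)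
        have hne : i ≠ j := by rintro rfl; exact lt_irrefl _ hij
        rw [hM₂_of_ne i j hi hj, hM, hshift i j, if_neg hne, if_neg]
        · simp
        · split_ifs at hij <;> omega
        · rw [Fin.le_def, Fin.le_def]; split_ifs at hij <;> omega
  have hprod : M₂.det = X ^ (n - 1) * p := by
    rw [htri.det_of_injective hb, ← Finset.prod_erase_mul _ _ (Finset.mem_univ t), hM₂_self]
    congr 1
    rw [Finset.prod_congr rfl (g := fun _ => (X : R[X])), Finset.prod_const,
      Finset.card_erase_of_mem (Finset.mem_univ t), Finset.card_univ, Fintype.card_fin]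
    intro i hi
    have hi : i ≠ t := Finset.ne_of_mem_erase hi
    rw [hM₂_of_ne i i hi hi, hM, hshift i i (fun h => hi (le_antisymm h.2 h.1))]
    simp
  exact (monic_X_pow (n - 1)).isRegular.left (hdet.symm.trans hprod)

theorem sum_C_mul_X_pow_rev_injective {R : Type*} [CommRing R] {n : ℕ} :
    Function.Injective fun a : Fin n → R =>
      ∑ k : Fin n, C (a k) * (X : R[X]) ^ (n - 1 - (k : ℕ)) := by
  intro a b h
  ext k
  have hcoeff : ∀ c : Fin n → R,
      (∑ l : Fin n, C (c l) * (X : R[X]) ^ (n - 1 - (l : ℕ))).coeff (n - 1 - k) = c k := by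
    intro c
    rw [finsetSum_coeff, Finset.sum_eq_single k]
    · simp
    · intro l _ hl
      rw [coeff_C_mul_X_pow, if_neg]
      intro h
      exact hl (Fin.ext (by have := l.isLt; have := k.isLt; omega))
    · simp
  rw [← hcoeff a, ← hcoeff b]
  exact congrArg (fun q : R[X] => q.coeff (n - 1 - k)) h

theorem HMat_apply_of_injective (F : Type*) [Field F] {n : ℕ} {pos : Fin n → Fin n × Fin n}
    (hinj : Function.Injective pos) (hle : ∀ k, ((pos k).2 : ℕ) ≤ ((pos k).1 : ℕ)) (k : Fin n) :
    HMat F pos (pos k).1 (pos k).2 = MvPolynomial.X k := by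
  have := hle k
  simp [HMat, hinj.eq_iff, show ¬ ((pos k).2 : ℕ) = (pos k).1 + 1 by omega]

theorem HMat_apply_of_forall_ne (F : Type*) [Field F] {n : ℕ} {pos : Fin n → Fin n × Fin n}
    {i j : Fin n} (h : ∀ k, pos k ≠ (i, j)) :
    HMat F pos i j = if (j : ℕ) = (i : ℕ) + 1 then 1 else 0 := by
  simp [HMat, h]

/-- A matrix `A ∈ Ĉ` is a companion matrix iff `s_{k−1}(A) = xₖ`
for every `k = 1,…,n`. -/
theorem mem_Chat_isCompanion_iff {F : Type*} [Field F] {n : ℕ} (hn : 0 < n)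
    (r : Fin n → Fin n) (hr : IsCIdx hn r)
    (A : Matrix (Fin n) (Fin n) (MvPolynomial (Fin n) F))
    (hA : IsULHSuperpatternOf A (CMat F r))
    (hblock : ∀ i j : Fin n, A i j ≠ 0 →
      ((j : ℕ) = (i : ℕ) + 1 ∨ ((r ⟨0, hn⟩ : ℕ) ≤ (i : ℕ) ∧ (j : ℕ) ≤ (r ⟨0, hn⟩ : ℕ)))) :
    IsCompanion A ↔ ∀ k : Fin n, subdiagSum A (k : ℕ) = MvPolynomial.X k := by
  have hle : ∀ k, ((CPos r k).2 : ℕ) ≤ ((CPos r k).1 : ℕ) := fun k => Nat.sub_le _ _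
  have hinj : Function.Injective (CPos r) := by
    intro k l h
    have h1 : (r k : ℕ) = r l := congrArg (fun q => (q.1 : ℕ)) h
    have h2 : (r k : ℕ) - k = r l - l := congrArg (fun q => (q.2 : ℕ)) h
    have := (hr k).1
    have := (hr l).1
    exact Fin.ext (by omega)
  have hupper : ∀ i j : Fin n, (i : ℕ) < j → A i j = if (j : ℕ) = (i : ℕ) + 1 then 1 else 0 := by
    intro i j hij
    rw [hA.1 i j hij, CMat, HMat_apply_of_forall_ne]
    intro k hk
    have := hle k
    rw [hk] at this
    exact absurd this (not_le.2 hij)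
  have hULH : IsULH A :=
    ⟨fun i j h => by rw [hupper i j (by omega), if_pos h],
      fun i j h => by rw [hupper i j (by omega), if_neg (by omega)]⟩
  have hpos : ∃ pos : Fin n → Fin n × Fin n, Function.Injective pos ∧
      (∀ k : Fin n, A (pos k).1 (pos k).2 = MvPolynomial.X k) ∧
      (∀ i j : Fin n, (∀ k, pos k ≠ (i, j)) → ∃ c : F, A i j = MvPolynomial.C c) := by
    refine ⟨CPos r, hinj, fun k => ?_, fun i j h => ?_⟩
    · have hX := HMat_apply_of_injective F hinj hle k
      rcases hA.2 _ _ (hle k) with h | ⟨h, -⟩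
      · rw [h, CMat, hX]
      · rw [CMat, hX] at h
        exact absurd h (MvPolynomial.X_ne_zero k)
    · rcases lt_or_ge (i : ℕ) (j : ℕ) with hij | hij
      · rw [hupper i j hij]
        exact ⟨if (j : ℕ) = (i : ℕ) + 1 then 1 else 0, by split_ifs <;> simp⟩
      · rcases hA.2 i j hij with h' | ⟨-, c, -, h'⟩
        · rw [h', CMat, HMat_apply_of_forall_ne F h, if_neg (by omega)]
          exact ⟨0, by simp⟩
        · exact ⟨c, h'⟩
  have hchar : A.charpoly = X ^ n -
      ∑ k : Fin n, C (subdiagSum A (k : ℕ)) * X ^ (n - 1 - (k : ℕ)) := by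
    refine hULH.charpoly_eq (r ⟨0, hn⟩) fun i j hji hb => ?_
    by_contra hne
    rcases hblock i j hne with h | h
    · rw [Fin.le_def] at hji
      omega
    · exact hb h
  rw [IsCompanion, and_iff_right hpos, hchar, sub_right_inj]
  exact (sum_C_mul_X_pow_rev_injective (n := n)).eq_iff
    (a := fun k => subdiagSum A (k : ℕ)) (b := MvPolynomial.X) |>.trans funext_iff
end
end
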